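/- Let I₁, I₂, I₃ be a measurable partition of I with λ(I₁) = λ(I₂) = λ(I₃) = 1/3, and consider the large game with action set A = {a, b, c} in which every player has the common payoff u(a, τ) = 0; u(b, τ) equal to −1 if 0 ≤ τ(b) < 0.2, to 10τ(b) − 3 if 0.2 ≤ τ(b) < 0.3, to 0 if 0.3 ≤ τ(b) < 0.8, and to 5τ(b) − 4 if 0.8 ≤ τ(b) ≤ 1; and u(c, τ) given by the same formula with τ(c) in place of τ(b). Let f : I → A be the pure strategy profile with f(i) = a on I₁, f(i) = b on I₂, f(i) = c on I₃. Then the Dirac randomized strategy profile i ↦ δ_{f(i)} is a Nash equilibrium that is admissible and aggregate robust, but it is not a randomized strategy robust perfect equilibrium. -/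

import Mathlib

open MeasureTheory Filter Topology

section RobustPerfect

variable {I : Type*} [MeasurableSpace I] {A : Type*} [Fintype A]

/-- The societal summary of a randomized strategy profile. -/
noncomputable def socSum (lam : Measure I) (h : I → A → ℝ) : A → ℝ :=
  fun a => ∫ i, h i a ∂lam

/-- `h` is a randomized strategy profile: a measurable map into the simplex. -/
def IsProfile (lam : Measure I) (h : I → A → ℝ) : Prop :=
  Measurable h ∧ ∀ i, h i ∈ stdSimplex ℝ A

/-- A large game: payoffs continuous on the simplex and measurable in the player. -/
def IsLargeGame (u : I → A → (A → ℝ) → ℝ) : Prop :=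
  (∀ i a, ContinuousOn (u i a) (stdSimplex ℝ A)) ∧
  (∀ (a : A) (τ : A → ℝ), τ ∈ stdSimplex ℝ A → Measurable fun i => u i a τ)

/-- An atomless measure. -/
def MeasAtomless (lam : Measure I) : Prop :=
  ∀ s : Set I, MeasurableSet s → 0 < lam s →
    ∃ t : Set I, MeasurableSet t ∧ t ⊆ s ∧ 0 < lam t ∧ lam t < lam s

/-- A Borel probability measure concentrated on the simplex with full support on it. -/
def FullSupportOnSimplex (η : Measure (A → ℝ)) : Prop :=
  IsProbabilityMeasure η ∧ η (stdSimplex ℝ A)ᶜ = 0 ∧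
    ∀ U : Set (A → ℝ), IsOpen U → (U ∩ stdSimplex ℝ A).Nonempty → 0 < η U

/-- A perturbation function: a Borel measurable map from the simplex to the
full-support Borel probability measures on the simplex. -/
def IsPerturbation (φ : (A → ℝ) → Measure (A → ℝ)) : Prop :=
  (∀ τ ∈ stdSimplex ℝ A, FullSupportOnSimplex (φ τ)) ∧
  ∀ f : (A → ℝ) → ℝ, Continuous f → Measurable fun τ => ∫ x, f x ∂(φ τ)

/-- Expected payoff of action `a` against a distribution over societal summaries. -/
noncomputable def payM (ui : A → (A → ℝ) → ℝ) (a : A) (ν : Measure (A → ℝ)) : ℝ :=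
  ∫ τ, ui a τ ∂ν

/-- Randomized strategy Nash equilibrium. -/
def IsNash (lam : Measure I) (u : I → A → (A → ℝ) → ℝ) (h : I → A → ℝ) : Prop :=
  IsProfile lam h ∧
  ∀ᵐ i ∂lam, ∀ μ ∈ stdSimplex ℝ A,
    ∑ a, μ a * u i a (socSum lam h) ≤ ∑ a, h i a * u i a (socSum lam h)

/-- A weakly dominated action. -/
def WeaklyDominated (ui : A → (A → ℝ) → ℝ) (a : A) : Prop :=
  ∃ μ ∈ stdSimplex ℝ A,
    (∀ τ ∈ stdSimplex ℝ A, ui a τ ≤ ∑ b, μ b * ui b τ) ∧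
    (∃ τ ∈ stdSimplex ℝ A, ui a τ < ∑ b, μ b * ui b τ)

/-- Admissibility: almost no player puts weight on a weakly dominated action. -/
def Admissible (lam : Measure I) (u : I → A → (A → ℝ) → ℝ) (h : I → A → ℝ) : Prop :=
  ∀ᵐ i ∂lam, ∀ a : A, WeaklyDominated (u i) a → h i a = 0

/-- Weak convergence of a sequence of measures to a Dirac measure. -/
def WeakTendstoDirac (ν : ℕ → Measure (A → ℝ)) (τ : A → ℝ) : Prop :=
  ∀ f : (A → ℝ) → ℝ, Continuous f →
    Tendsto (fun n => ∫ x, f x ∂(ν n)) atTop (nhds (f τ))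

/-- Aggregate robustness. -/
def AggregateRobust (lam : Measure I) (u : I → A → (A → ℝ) → ℝ) (h : I → A → ℝ) : Prop :=
  ∀ᵐ i ∂lam, ∃ φ : ℕ → (A → ℝ) → Measure (A → ℝ),
    (∀ n, IsPerturbation (φ n)) ∧
    (∀ τ ∈ stdSimplex ℝ A, WeakTendstoDirac (fun n => φ n τ) τ) ∧
    ∀ n, ∀ μ ∈ stdSimplex ℝ A,
      ∑ a, μ a * payM (u i) a (φ n (socSum lam h)) ≤
        ∑ a, h i a * payM (u i) a (φ n (socSum lam h))

/-- `ε`-robust perfect equilibrium with perturbed player space `Iε` and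
perturbation function `φ`. -/
def IsEpsRPE (lam : Measure I) (u : I → A → (A → ℝ) → ℝ) (ε : ℝ)
    (h : I → A → ℝ) (Iε : Set I) (φ : (A → ℝ) → Measure (A → ℝ)) : Prop :=
  IsProfile lam h ∧
  (∀ᵐ i ∂lam, ∀ a : A, 0 < h i a) ∧
  MeasurableSet Iε ∧ ENNReal.ofReal (1 - ε) < lam Iε ∧
  IsPerturbation φ ∧
  (∀ τ ∈ stdSimplex ℝ A, ENNReal.ofReal (1 - ε) ≤ φ τ {τ}) ∧
  ∀ i ∈ Iε, ∀ am al : A,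
    payM (u i) am (φ (socSum lam h)) < payM (u i) al (φ (socSum lam h)) →
      h i am ≤ ε

/-- Robust perfect equilibrium. -/
def IsRPE (lam : Measure I) (u : I → A → (A → ℝ) → ℝ) (h : I → A → ℝ) : Prop :=
  IsProfile lam h ∧
  ∃ (ε : ℕ → ℝ) (hs : ℕ → I → A → ℝ) (Is : ℕ → Set I)
      (φs : ℕ → (A → ℝ) → Measure (A → ℝ)),
    (∀ n, 0 < ε n) ∧ Tendsto ε atTop (nhds 0) ∧
    (∀ n, IsEpsRPE lam u (ε n) (hs n) (Is n) (φs n)) ∧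
    (∀ᵐ i ∂lam, ∃ nk : ℕ → ℕ, StrictMono nk ∧ (∀ k, i ∈ Is (nk k)) ∧
      Tendsto (fun k => hs (nk k) i) atTop (nhds (h i))) ∧
    Tendsto (fun n => socSum lam (hs n)) atTop (nhds (socSum lam h))

/-- The Dirac randomized strategy profile induced by a pure strategy profile. -/
def diracProfile [DecidableEq A] (f : I → A) : I → A → ℝ :=
  fun i a => if a = f i then 1 else 0

end RobustPerfect

/-- The piecewise payoff used on paths `b` and `c` in the counterexample game. -/
noncomputable def wPay (t : ℝ) : ℝ :=
  if t < 0.2 then -1 else if t < 0.3 then 10*t - 3 else if t < 0.8 then 0 else 5*t - 4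
section SimplexMeasures

variable {A : Type*} [Fintype A]

/-- The mixture `(1 - t) δ_τ + t η`. -/
noncomputable def diracMixture (t : ℝ) (τ : A → ℝ) (η : Measure (A → ℝ)) : Measure (A → ℝ) :=
  ENNReal.ofReal (1 - t) • Measure.dirac τ + ENNReal.ofReal t • η

lemma measurableSet_stdSimplex : MeasurableSet (stdSimplex ℝ A) :=
  (isClosed_stdSimplex (𝕜 := ℝ) (ι := A)).measurableSet

lemma FullSupportOnSimplex.ae_mem {η : Measure (A → ℝ)} (hη : FullSupportOnSimplex η) :
    ∀ᵐ τ ∂η, τ ∈ stdSimplex ℝ A := hη.2.1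

lemma FullSupportOnSimplex.integrable_of_continuous {η : Measure (A → ℝ)}
    (hη : FullSupportOnSimplex η) {g : (A → ℝ) → ℝ} (hg : Continuous g) : Integrable g η := by
  have := hη.1
  obtain ⟨C, hC⟩ := (isCompact_stdSimplex ℝ A).exists_bound_of_continuousOn hg.continuousOn
  exact Integrable.of_bound hg.aestronglyMeasurable C (hη.ae_mem.mono fun τ hτ => hC τ hτ)

lemma integral_diracMixture {t : ℝ} (h0 : 0 ≤ t) (h1 : t ≤ 1) (τ : A → ℝ)
    {η : Measure (A → ℝ)} {g : (A → ℝ) → ℝ} (hg : Integrable g η) :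
    ∫ x, g x ∂(diracMixture t τ η) = (1 - t) * g τ + t * ∫ x, g x ∂η := by
  have hd : Integrable g (Measure.dirac τ) := integrable_dirac (by simp)
  rw [diracMixture, integral_add_measure (hd.smul_measure ENNReal.ofReal_ne_top)
    (hg.smul_measure ENNReal.ofReal_ne_top), integral_smul_measure, integral_smul_measure,
    integral_dirac, ENNReal.toReal_ofReal (by linarith), ENNReal.toReal_ofReal h0]
  simp

lemma FullSupportOnSimplex.diracMixture {t : ℝ} (h0 : 0 < t) (h1 : t ≤ 1) {τ : A → ℝ}
    (hτ : τ ∈ stdSimplex ℝ A) {η : Measure (A → ℝ)} (hη : FullSupportOnSimplex η) :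
    FullSupportOnSimplex (diracMixture t τ η) := by
  have := hη.1
  refine ⟨⟨?_⟩, ?_, fun U hU hne => ?_⟩
  · simp only [_root_.diracMixture, Measure.add_apply, Measure.smul_apply, measure_univ,
      smul_eq_mul, mul_one]
    rw [← ENNReal.ofReal_add (by linarith) h0.le]
    simp
  · simp [_root_.diracMixture, hη.2.1, Measure.dirac_apply' _ measurableSet_stdSimplex.compl, hτ]
  · have hpos : 0 < ENNReal.ofReal t * η U :=
      ENNReal.mul_pos (by simpa using h0) (hη.2.2 U hU hne).ne'
    simp only [_root_.diracMixture, Measure.add_apply, Measure.smul_apply, smul_eq_mul]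
    exact hpos.trans_le le_add_self

lemma isPerturbation_diracMixture {t : ℝ} (h0 : 0 < t) (h1 : t ≤ 1) {η : Measure (A → ℝ)}
    (hη : FullSupportOnSimplex η) : IsPerturbation fun τ => diracMixture t τ η := by
  refine ⟨fun τ hτ => hη.diracMixture h0 h1 hτ, fun g hg => ?_⟩
  simp only [integral_diracMixture h0.le h1 _ (hη.integrable_of_continuous hg)]
  have := hg.measurable
  fun_prop

lemma weakTendstoDirac_diracMixture {t : ℕ → ℝ} (h0 : ∀ n, 0 < t n) (h1 : ∀ n, t n ≤ 1)
    (ht : Tendsto t atTop (𝓝 0)) {η : Measure (A → ℝ)} (hη : FullSupportOnSimplex η)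
    (τ : A → ℝ) : WeakTendstoDirac (fun n => diracMixture (t n) τ η) τ := by
  intro g hg
  simp only [integral_diracMixture (h0 _).le (h1 _) _ (hη.integrable_of_continuous hg)]
  simpa using ((ht.const_sub 1).mul_const (g τ)).add (ht.mul_const (∫ x, g x ∂η))

lemma exists_fullSupportOnSimplex [Nonempty A] :
    ∃ η : Measure (A → ℝ), FullSupportOnSimplex η := by
  classical
  have : Nonempty (stdSimplex ℝ A) :=
    ⟨⟨_, single_mem_stdSimplex ℝ (Classical.arbitrary A)⟩⟩
  let x : ℕ → (A → ℝ) := fun n => (TopologicalSpace.denseSeq (stdSimplex ℝ A) n : A → ℝ)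
  have hx : Measurable x := measurable_from_nat
  refine ⟨(ProbabilityTheory.poissonMeasure 1).map x,
    Measure.isProbabilityMeasure_map hx.aemeasurable, ?_, fun U hU hne => ?_⟩
  · rw [Measure.map_apply hx measurableSet_stdSimplex.compl]
    have hempty : x ⁻¹' (stdSimplex ℝ A)ᶜ = ∅ :=
      Set.eq_empty_of_forall_notMem fun n hn => hn (Subtype.prop _)
    rw [hempty, measure_empty]
  · rw [Measure.map_apply hx hU.measurableSet]
    obtain ⟨y, hyU, hy⟩ := hne
    obtain ⟨n, hn⟩ := (TopologicalSpace.denseRange_denseSeq (stdSimplex ℝ A)).exists_mem_open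
      (hU.preimage continuous_subtype_val) ⟨⟨y, hy⟩, hyU⟩
    refine lt_of_lt_of_le ?_ (measure_mono (Set.singleton_subset_iff.2 hn))
    rw [ProbabilityTheory.poissonMeasure_singleton]
    simp only [ENNReal.ofReal_pos]
    positivity

lemma sum_mul_le_of_mem_stdSimplex {μ p : A → ℝ} (hμ : μ ∈ stdSimplex ℝ A) {C : ℝ}
    (hp : ∀ a, p a ≤ C) : ∑ a, μ a * p a ≤ C := by
  calc ∑ a, μ a * p a ≤ ∑ a, μ a * C :=
        Finset.sum_le_sum fun a _ => mul_le_mul_of_nonneg_left (hp a) (hμ.1 a)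
    _ = C := by rw [← Finset.sum_mul, hμ.2, one_mul]

end SimplexMeasures

section Profiles

variable {I : Type*} [MeasurableSpace I] {A : Type*} [Fintype A]

lemma IsProfile.le_one {lam : Measure I} {h : I → A → ℝ} (hh : IsProfile lam h) (i : I) (a : A) :
    h i a ≤ 1 := by
  rw [← (hh.2 i).2]
  exact Finset.single_le_sum (fun b _ => (hh.2 i).1 b) (Finset.mem_univ a)

lemma IsProfile.integrable {lam : Measure I} [IsProbabilityMeasure lam] {h : I → A → ℝ}
    (hh : IsProfile lam h) (a : A) : Integrable (fun i => h i a) lam := by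
  refine Integrable.of_bound ((measurable_pi_apply a).comp hh.1).aestronglyMeasurable 1
    (Eventually.of_forall fun i => ?_)
  rw [Real.norm_of_nonneg ((hh.2 i).1 a)]
  exact hh.le_one i a

lemma IsProfile.socSum_mem {lam : Measure I} [IsProbabilityMeasure lam] {h : I → A → ℝ}
    (hh : IsProfile lam h) : socSum lam h ∈ stdSimplex ℝ A := by
  refine ⟨fun a => integral_nonneg fun i => (hh.2 i).1 a, ?_⟩
  simp only [socSum]
  rw [← integral_finsetSum _ fun a _ => hh.integrable a]
  simp [(hh.2 _).2]

/-- If all players in a set of measure above `1 - ε` play `a` with probability at most `ε`, then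
`a` has aggregate weight at most `2 * ε`. -/
lemma IsProfile.socSum_le_two_mul {lam : Measure I} [IsProbabilityMeasure lam] {h : I → A → ℝ}
    (hh : IsProfile lam h) {ε : ℝ} (hε : 0 < ε) {S : Set I} (hS : MeasurableSet S)
    (hlam : ENNReal.ofReal (1 - ε) < lam S) {a : A} (ha : ∀ i ∈ S, h i a ≤ ε) :
    socSum lam h a ≤ 2 * ε := by
  have hreal : 1 - ε ≤ lam.real S := by
    rcases le_or_gt (1 - ε) 0 with h0 | h0
    · exact h0.trans measureReal_nonneg
    · exact ((ENNReal.ofReal_lt_iff_lt_toReal h0.le (measure_ne_top _ _)).1 hlam).le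
  have hint : Integrable (fun i => ε + Sᶜ.indicator (fun _ => (1 : ℝ)) i) lam :=
    (integrable_const _).add ((integrable_const _).indicator hS.compl)
  calc socSum lam h a ≤ ∫ i, (ε + Sᶜ.indicator (fun _ => (1 : ℝ)) i) ∂lam := by
        refine integral_mono (hh.integrable a) hint fun i => ?_
        by_cases hi : i ∈ S
        · simpa [hi] using ha i hi
        · simpa [hi] using (hh.le_one i a).trans (by linarith)
    _ = ε + lam.real Sᶜ := by
        rw [integral_add (integrable_const _) ((integrable_const _).indicator hS.compl),
          integral_indicator_const _ hS.compl]
        simp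
    _ ≤ 2 * ε := by
        rw [probReal_compl_eq_one_sub hS]
        linarith

variable [DecidableEq A]

lemma isProfile_diracProfile [MeasurableSpace A] [MeasurableSingletonClass A]
    (lam : Measure I) {f : I → A} (hf : Measurable f) :
    IsProfile lam (diracProfile f) := by
  refine ⟨measurable_pi_lambda _ fun a => ?_, fun i => ⟨fun a => ?_, ?_⟩⟩
  · have hset : MeasurableSet {i | a = f i} := by
      simpa [Set.preimage, eq_comm] using hf (measurableSet_singleton a)
    exact Measurable.ite hset measurable_const measurable_const
  · simp only [diracProfile]
    split_ifs <;> norm_num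
  · simp [diracProfile]

lemma socSum_diracProfile [MeasurableSpace A] [MeasurableSingletonClass A]
    (lam : Measure I) {f : I → A} (hf : Measurable f) (a : A) :
    socSum lam (diracProfile f) a = lam.real (f ⁻¹' {a}) := by
  rw [← integral_indicator_one (hf (measurableSet_singleton a))]
  refine integral_congr_ae (Eventually.of_forall fun i => ?_)
  by_cases hi : a = f i
  · simp [diracProfile, hi]
  · simp [diracProfile, hi, Ne.symm hi]

end Profiles

section Game

lemma measurable_wPay : Measurable wPay := by
  refine Measurable.ite measurableSet_Iio measurable_const (Measurable.ite measurableSet_Iio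
    (by fun_prop) (Measurable.ite measurableSet_Iio measurable_const (by fun_prop)))

lemma neg_one_le_wPay (t : ℝ) : -1 ≤ wPay t := by
  unfold wPay
  split_ifs <;> linarith

lemma wPay_le_one {t : ℝ} (ht : t ≤ 1) : wPay t ≤ 1 := by
  unfold wPay
  split_ifs <;> linarith

lemma wPay_of_lt {t : ℝ} (ht : t < 0.2) : wPay t = -1 := if_pos ht

lemma wPay_one : wPay 1 = 1 := by norm_num [wPay]

lemma wPay_zero : wPay 0 = -1 := by norm_num [wPay]

lemma wPay_one_third : wPay (1 / 3) = 0 := by norm_num [wPay]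

lemma wPay_add_wPay_nonpos {s t : ℝ} (hs : 0 ≤ s) (ht : 0 ≤ t) (hst : s + t ≤ 1) :
    wPay s + wPay t ≤ 0 := by
  unfold wPay
  split_ifs <;> linarith

/-- The common payoff of the players. -/
noncomputable def gamePay (a : Fin 3) (τ : Fin 3 → ℝ) : ℝ :=
  if a = 0 then 0 else if a = 1 then wPay (τ 1) else wPay (τ 2)

lemma gamePay_zero (τ : Fin 3 → ℝ) : gamePay 0 τ = 0 := rfl

lemma gamePay_one (τ : Fin 3 → ℝ) : gamePay 1 τ = wPay (τ 1) := rfl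

lemma gamePay_two (τ : Fin 3 → ℝ) : gamePay 2 τ = wPay (τ 2) := rfl

lemma measurable_gamePay (a : Fin 3) : Measurable (gamePay a) := by
  fin_cases a
  · exact measurable_const
  · exact measurable_wPay.comp (measurable_pi_apply _)
  · exact measurable_wPay.comp (measurable_pi_apply _)

lemma abs_gamePay_le_one (a : Fin 3) {τ : Fin 3 → ℝ} (hτ : τ ∈ stdSimplex ℝ (Fin 3)) :
    |gamePay a τ| ≤ 1 := by
  have hle : ∀ k, τ k ≤ 1 := fun k => by
    rw [← hτ.2]
    exact Finset.single_le_sum (fun b _ => hτ.1 b) (Finset.mem_univ k)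
  rw [abs_le]
  fin_cases a
  · simp [gamePay_zero]
  · exact ⟨neg_one_le_wPay _, wPay_le_one (hle 1)⟩
  · exact ⟨neg_one_le_wPay _, wPay_le_one (hle 2)⟩

lemma integrable_gamePay {η : Measure (Fin 3 → ℝ)} (hη : FullSupportOnSimplex η) (a : Fin 3) :
    Integrable (gamePay a) η := by
  have := hη.1
  exact Integrable.of_bound (measurable_gamePay a).aestronglyMeasurable 1
    (hη.ae_mem.mono fun τ hτ => abs_gamePay_le_one a hτ)

lemma abs_integral_gamePay_le_one {η : Measure (Fin 3 → ℝ)} (hη : FullSupportOnSimplex η)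
    (a : Fin 3) : |∫ τ, gamePay a τ ∂η| ≤ 1 := by
  have := hη.1
  simpa using norm_integral_le_of_norm_le_const (μ := η) (f := gamePay a) (C := 1)
    (hη.ae_mem.mono fun τ hτ => abs_gamePay_le_one a hτ)

lemma not_weaklyDominated_gamePay (a : Fin 3) : ¬ WeaklyDominated gamePay a := by
  rintro ⟨μ, hμ, hle, τ, hτ, hlt⟩
  have hvertex := hle (Pi.single a 1) (single_mem_stdSimplex ℝ a)
  have hsum := hμ.2
  have h0 := hμ.1 0
  have h1 := hμ.1 1
  have h2 := hμ.1 2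
  rw [Fin.sum_univ_three] at hvertex hlt hsum
  fin_cases a
  · simp [gamePay_zero, gamePay_one, gamePay_two, wPay_zero] at hvertex hlt
    have e1 : μ 1 = 0 := by linarith
    have e2 : μ 2 = 0 := by linarith
    simp [e1, e2] at hlt
  · simp [gamePay_zero, gamePay_one, gamePay_two, wPay_zero, wPay_one] at hvertex hlt
    have e1 : μ 1 = 1 := by linarith
    have e2 : μ 2 = 0 := by linarith
    simp [e1, e2] at hlt
  · simp [gamePay_zero, gamePay_one, gamePay_two, wPay_zero, wPay_one] at hvertex hlt
    have e1 : μ 1 = 0 := by linarith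
    have e2 : μ 2 = 1 := by linarith
    simp [e1, e2] at hlt

/-- Every action is optimal against a suitable full-support belief: mix any full-support belief
with the vertex of that action. -/
lemma exists_fullSupport_gamePay_le (k : Fin 3) : ∃ η : Measure (Fin 3 → ℝ),
    FullSupportOnSimplex η ∧ ∀ a, ∫ τ, gamePay a τ ∂η ≤ ∫ τ, gamePay k τ ∂η := by
  obtain ⟨η, hη⟩ := exists_fullSupportOnSimplex (A := Fin 3)
  refine ⟨diracMixture (1 / 2) (Pi.single k 1) η,
    hη.diracMixture (by norm_num) (by norm_num) (single_mem_stdSimplex ℝ k), fun a => ?_⟩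
  rw [integral_diracMixture (by norm_num) (by norm_num) _ (integrable_gamePay hη a),
    integral_diracMixture (by norm_num) (by norm_num) _ (integrable_gamePay hη k)]
  have hzero : ∫ τ, gamePay 0 τ ∂η = 0 := by simp [gamePay_zero]
  have hone := abs_le.1 (abs_integral_gamePay_le_one hη 1)
  have htwo := abs_le.1 (abs_integral_gamePay_le_one hη 2)
  fin_cases k <;> fin_cases a <;>
    simp [gamePay_zero, gamePay_one, gamePay_two, wPay_zero, wPay_one] at hone htwo ⊢ <;> linarith

/-- Against a full-support belief the payoffs of the last two actions have negative sum. -/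
lemma integral_gamePay_one_add_two_neg {η : Measure (Fin 3 → ℝ)} (hη : FullSupportOnSimplex η) :
    ∫ τ, gamePay 1 τ ∂η + ∫ τ, gamePay 2 τ ∂η < 0 := by
  have hi := (integrable_gamePay hη 1).add (integrable_gamePay hη 2)
  rw [← integral_add (integrable_gamePay hη 1) (integrable_gamePay hη 2)]
  have hnonneg : 0 ≤ᵐ[η] fun τ => -(gamePay 1 τ + gamePay 2 τ) := by
    filter_upwards [hη.ae_mem] with τ hτ
    have hsum := hτ.2
    rw [Fin.sum_univ_three] at hsum
    have h0 := hτ.1 0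
    have := wPay_add_wPay_nonpos (hτ.1 1) (hτ.1 2) (by linarith)
    simpa [gamePay_one, gamePay_two] using by linarith
  have hpos : 0 < ∫ τ, -(gamePay 1 τ + gamePay 2 τ) ∂η := by
    rw [integral_pos_iff_support_of_nonneg_ae hnonneg hi.neg]
    have hU : IsOpen {τ : Fin 3 → ℝ | τ 1 < 0.2 ∧ τ 2 < 0.2} :=
      (isOpen_lt (continuous_apply 1) continuous_const).inter
        (isOpen_lt (continuous_apply 2) continuous_const)
    refine (hη.2.2 _ hU ⟨Pi.single 0 1, ?_, single_mem_stdSimplex ℝ 0⟩).trans_le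
      (measure_mono fun τ hτ => ?_)
    · simp
      norm_num
    · simp only [Function.mem_support, gamePay_one, gamePay_two, wPay_of_lt hτ.1, wPay_of_lt hτ.2]
      norm_num
  rw [integral_neg] at hpos
  linarith

variable {I : Type*} [MeasurableSpace I]

/-- In an `ε`-robust perfect equilibrium the second or the third action is worse than the first,
so a robust perfect equilibrium cannot give positive aggregate weight to both of them. -/
lemma not_isRPE_gamePay (lam : Measure I) [IsProbabilityMeasure lam] {h : I → Fin 3 → ℝ}
    (h1 : 0 < socSum lam h 1) (h2 : 0 < socSum lam h 2) : ¬ IsRPE lam (fun _ => gamePay) h := by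
  rintro ⟨-, ε, hs, Is, φs, hεpos, hε, heps, -, hsoc⟩
  have hkeep : ∀ a : Fin 3, 0 < socSum lam h a → ∀ᶠ n in atTop,
      0 ≤ ∫ τ, gamePay a τ ∂(φs n (socSum lam (hs n))) := by
    intro a ha
    have hlim : Tendsto (fun n => socSum lam (hs n) a - 2 * ε n) atTop (𝓝 (socSum lam h a)) := by
      simpa using ((tendsto_pi_nhds.1 hsoc) a).sub (hε.const_mul 2)
    filter_upwards [hlim.eventually_const_lt ha] with n hn
    obtain ⟨hprof, -, hmeas, hlam, -, -, hopt⟩ := heps n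
    by_contra! hneg
    have := hprof.socSum_le_two_mul (hεpos n) hmeas hlam (a := a) fun i hi =>
      hopt i hi a 0 (by simpa [payM, gamePay_zero] using hneg)
    linarith
  obtain ⟨n, hn1, hn2⟩ := ((hkeep 1 h1).and (hkeep 2 h2)).exists
  obtain ⟨hprof, -, -, -, hφ, -, -⟩ := heps n
  have := integral_gamePay_one_add_two_neg (hφ.1 _ hprof.socSum_mem)
  linarith

lemma aggregateRobust_diracProfile_gamePay (lam : Measure I) {f : I → Fin 3}
    (hsoc : ∀ a, gamePay a (socSum lam (diracProfile f)) = 0) :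
    AggregateRobust lam (fun _ => gamePay) (diracProfile f) := by
  refine Eventually.of_forall fun i => ?_
  obtain ⟨η, hη, hopt⟩ := exists_fullSupport_gamePay_le (f i)
  have h0 : ∀ n : ℕ, (0 : ℝ) < 1 / (n + 1) := fun n => by positivity
  have h1 : ∀ n : ℕ, (1 : ℝ) / (n + 1) ≤ 1 := fun n => by
    rw [div_le_one (by positivity)]
    linarith [n.cast_nonneg (α := ℝ)]
  refine ⟨fun n τ => diracMixture (1 / ((n : ℝ) + 1)) τ η,
    fun n => isPerturbation_diracMixture (h0 n) (h1 n) hη,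
    fun τ _ => weakTendstoDirac_diracMixture h0 h1 tendsto_one_div_add_atTop_nhds_zero_nat hη τ,
    fun n μ hμ => ?_⟩
  have hpay : ∀ a, payM gamePay a
      (diracMixture (1 / ((n : ℝ) + 1)) (socSum lam (diracProfile f)) η) =
        1 / ((n : ℝ) + 1) * ∫ τ, gamePay a τ ∂η := fun a => by
    rw [payM, integral_diracMixture (h0 n).le (h1 n) _ (integrable_gamePay hη a), hsoc, mul_zero,
      zero_add]
  simp only [hpay]
  refine (sum_mul_le_of_mem_stdSimplex hμ fun a =>
    mul_le_mul_of_nonneg_left (hopt a) (h0 n).le).trans_eq ?_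
  simp [diracProfile]

end Game

/-- In the three-action game with common payoff `u(a,τ) = 0`,
`u(b,τ) = wPay (τ b)`, `u(c,τ) = wPay (τ c)`, the pure strategy profile playing
`a` on `I₁`, `b` on `I₂` and `c` on `I₃` (a measurable partition into sets of
measure `1/3`) induces a Dirac randomized strategy profile that is a Nash
equilibrium, admissible and aggregate robust, but is not a robust perfect
equilibrium. -/
theorem statement19 {I : Type*} [MeasurableSpace I]
    (lam : Measure I) [IsProbabilityMeasure lam] (hatomless : MeasAtomless lam)
    (I1 I2 I3 : Set I)
    (hm1 : MeasurableSet I1) (hm2 : MeasurableSet I2) (hm3 : MeasurableSet I3)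
    (hd12 : Disjoint I1 I2) (hd13 : Disjoint I1 I3) (hd23 : Disjoint I2 I3)
    (hcover : I1 ∪ I2 ∪ I3 = Set.univ)
    (hμ1 : lam I1 = ENNReal.ofReal (1/3)) (hμ2 : lam I2 = ENNReal.ofReal (1/3))
    (hμ3 : lam I3 = ENNReal.ofReal (1/3))
    (u : I → Fin 3 → (Fin 3 → ℝ) → ℝ)
    (hu : u = fun _ a τ => if a = 0 then 0 else if a = 1 then wPay (τ 1) else wPay (τ 2))
    (f : I → Fin 3)
    (hf1 : ∀ i ∈ I1, f i = 0) (hf2 : ∀ i ∈ I2, f i = 1) (hf3 : ∀ i ∈ I3, f i = 2) :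
    IsNash lam u (diracProfile f) ∧ Admissible lam u (diracProfile f) ∧
      AggregateRobust lam u (diracProfile f) ∧ ¬ IsRPE lam u (diracProfile f) := by
  have hpre : ∀ {S : Set I} {k : Fin 3}, (∀ i ∈ S, f i = k) → (∀ i ∉ S, f i ≠ k) →
      f ⁻¹' {k} = S := fun h h' => Set.ext fun i => ⟨fun hi => by_contra fun hn => h' i hn hi, h i⟩
  have hmem : ∀ i, i ∈ I1 ∨ i ∈ I2 ∨ i ∈ I3 := fun i => by
    have : i ∈ I1 ∪ I2 ∪ I3 := hcover ▸ Set.mem_univ i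
    simpa [or_assoc] using this
  have hpre1 : f ⁻¹' {0} = I1 := hpre hf1 fun i hi => by
    rcases hmem i with h | h | h
    · exact absurd h hi
    · simp [hf2 i h]
    · simp [hf3 i h]
  have hpre2 : f ⁻¹' {1} = I2 := hpre hf2 fun i hi => by
    rcases hmem i with h | h | h
    · simp [hf1 i h]
    · exact absurd h hi
    · simp [hf3 i h]
  have hpre3 : f ⁻¹' {2} = I3 := hpre hf3 fun i hi => by
    rcases hmem i with h | h | h
    · simp [hf1 i h]
    · simp [hf2 i h]
    · exact absurd h hi
  have hf : Measurable f := measurable_to_countable' fun k => by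
    fin_cases k
    · exact hpre1 ▸ hm1
    · exact hpre2 ▸ hm2
    · exact hpre3 ▸ hm3
  have hsoc1 : socSum lam (diracProfile f) 1 = 1 / 3 := by
    rw [socSum_diracProfile lam hf, hpre2, measureReal_def, hμ2, ENNReal.toReal_ofReal (by norm_num)]
  have hsoc2 : socSum lam (diracProfile f) 2 = 1 / 3 := by
    rw [socSum_diracProfile lam hf, hpre3, measureReal_def, hμ3, ENNReal.toReal_ofReal (by norm_num)]
  have hzero : ∀ a, gamePay a (socSum lam (diracProfile f)) = 0 := fun a => by
    fin_cases a
    · exact gamePay_zero _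
    · exact (congrArg wPay hsoc1).trans wPay_one_third
    · exact (congrArg wPay hsoc2).trans wPay_one_third
  obtain rfl : u = fun _ => gamePay := hu
  refine ⟨⟨isProfile_diracProfile lam hf, Eventually.of_forall fun i μ hμ => ?_⟩,
    Eventually.of_forall fun i a ha => (not_weaklyDominated_gamePay a ha).elim,
    aggregateRobust_diracProfile_gamePay lam hzero,
    not_isRPE_gamePay lam (by rw [hsoc1]; norm_num) (by rw [hsoc2]; norm_num)⟩
  simp [hzero]
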